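/- For x in the open unit ball of ℝ^{n+1} and ζ ∈ S^n, the map M_x extends continuously to S^n and its Jacobian (with respect to the spherical measure) at ζ ∈ S^n equals ((1-‖x‖²)/‖ζ+x‖²)^n. -/

import Mathlib

open MeasureTheory Metric
open scoped RealInnerProductSpace

/-- The Möbius transformation `M_x` of the unit ball sending `0` to `x`. -/
noncomputable def Mob {E : Type*} [NormedAddCommGroup E] [InnerProductSpace ℝ E]
    (x z : E) : E :=
  (1 + ‖x‖ ^ 2 * ‖z‖ ^ 2 + 2 * ⟪x, z⟫)⁻¹ •
    ((1 - ‖x‖ ^ 2) • z + (1 + ‖z‖ ^ 2 + 2 * ⟪x, z⟫) • x)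

/-- Two rotation invariant probability measures on the unit sphere coincide. -/
lemma aux_unique {E : Type*} [NormedAddCommGroup E] [InnerProductSpace ℝ E]
    [FiniteDimensional ℝ E] [MeasurableSpace E] [BorelSpace E]
    (μ ν : Measure E) [IsProbabilityMeasure μ] [IsProbabilityMeasure ν]
    (hμ : μ (Metric.sphere (0 : E) 1)ᶜ = 0) (hν : ν (Metric.sphere (0 : E) 1)ᶜ = 0)
    (hμi : ∀ R : E ≃ₗᵢ[ℝ] E, Measure.map R μ = μ)
    (hνi : ∀ R : E ≃ₗᵢ[ℝ] E, Measure.map R ν = ν) : μ = ν := by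
  have key : ∀ (ρ : Measure E), (∀ R : E ≃ₗᵢ[ℝ] E, Measure.map R ρ = ρ) →
      ∀ v w : E, ‖v‖ = ‖w‖ → charFun ρ v = charFun ρ w := by
    intro ρ hρ v w hvw
    let R := (ℝ ∙ (v - w))ᗮ.reflection
    have hR : R v = w := Submodule.reflection_sub hvw
    rw [charFun_apply, charFun_apply]
    conv_rhs => rw [← hρ R]
    have hm : AEMeasurable (R : E → E) ρ := R.continuous.measurable.aemeasurable
    rw [integral_map hm (Continuous.aestronglyMeasurable (by fun_prop))]
    congr 1
    ext y
    rw [← hR, LinearIsometryEquiv.inner_map_map]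
  have hμs : ∀ᵐ z ∂μ, ‖z‖ = 1 := by
    have : ∀ᵐ z ∂μ, z ∈ Metric.sphere (0 : E) 1 := hμ
    filter_upwards [this] with z hz using by simpa using hz
  have hνs : ∀ᵐ z ∂ν, ‖z‖ = 1 := by
    have : ∀ᵐ z ∂ν, z ∈ Metric.sphere (0 : E) 1 := hν
    filter_upwards [this] with z hz using by simpa using hz
  apply Measure.ext_of_charFun
  ext t
  have h1 : ∫ w, charFun μ (‖t‖ • w) ∂ν = charFun μ t := by
    rw [integral_congr_ae (g := fun _ => charFun μ t)]
    · simp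
    · filter_upwards [hνs] with w hw
      exact key μ hμi _ _ (by simp [norm_smul, hw])
  have h2 : ∫ z, charFun ν (‖t‖ • z) ∂μ = charFun ν t := by
    rw [integral_congr_ae (g := fun _ => charFun ν t)]
    · simp
    · filter_upwards [hμs] with w hw
      exact key ν hνi _ _ (by simp [norm_smul, hw])
  rw [← h1, ← h2]
  simp only [charFun_apply]
  rw [integral_integral_swap]
  · congr 1; ext z; congr 1; ext w
    rw [inner_smul_right, inner_smul_right, real_inner_comm]
  · refine Integrable.of_bound (C := 1) (Continuous.aestronglyMeasurable ?_) ?_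
    · unfold Function.uncurry; fun_prop
    · refine Filter.Eventually.of_forall fun p => ?_
      simp only [Function.uncurry]
      rw [Complex.norm_exp_ofReal_mul_I]

/-- Polar coordinates. -/
lemma aux_polar {E : Type*} [NormedAddCommGroup E] [InnerProductSpace ℝ E]
    [FiniteDimensional ℝ E] [MeasurableSpace E] [BorelSpace E] (n : ℕ)
    (hdim : Module.finrank ℝ E = n + 1) (k : E → ENNReal) (hk : Measurable k)
    (c : E → ℝ) (hc : Measurable c) (hc0 : ∀ z, ‖z‖ = 1 → 0 < c z) :
    ∫⁻ y, k (‖y‖⁻¹ • y) * (Set.indicator {y : E | ‖y‖ * c (‖y‖⁻¹ • y) < 1} 1 y) ∂(volume : Measure E)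
      = ∫⁻ z : sphere (0 : E) 1, k z * ENNReal.ofReal ((c z)⁻¹ ^ (n + 1) / (n + 1))
        ∂(volume : Measure E).toSphere := by
  have : Nontrivial E := Module.nontrivial_of_finrank_pos (R := ℝ) (by omega)
  let S : Set (sphere (0 : E) 1 × Set.Ioi (0 : ℝ)) := {p | (p.2 : ℝ) * c p.1 < 1}
  have hS : MeasurableSet S := by
    apply measurableSet_lt
    · exact (measurable_subtype_coe.comp measurable_snd).mul
        (hc.comp (measurable_subtype_coe.comp measurable_fst))
    · exact measurable_const
  let F : sphere (0 : E) 1 × Set.Ioi (0 : ℝ) → ENNReal := fun p => k p.1 * S.indicator 1 p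
  have hF : Measurable F := (hk.comp (measurable_subtype_coe.comp measurable_fst)).mul
    (measurable_one.indicator hS)
  have hp := ((volume : Measure E).measurePreserving_homeomorphUnitSphereProd).lintegral_comp hF
  rw [hdim, Nat.add_sub_cancel, lintegral_prod _ hF.aemeasurable] at hp
  conv_lhs => rw [← restrict_compl_singleton (μ := (volume : Measure E)) 0,
    ← lintegral_subtype_comap (measurableSet_singleton _).compl]
  refine Eq.trans ?_ (hp.trans ?_)
  · apply lintegral_congr
    intro y
    simp only [F, S, Set.indicator, Set.mem_ofPred_eq, homeomorphUnitSphereProd_apply_fst_coe,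
      homeomorphUnitSphereProd_apply_snd_coe]
    rfl
  · apply lintegral_congr
    intro z
    have hz : 0 < c z := hc0 z (by simpa using z.2)
    have hmS : MeasurableSet (Set.Iio (⟨(c z)⁻¹, inv_pos.2 hz⟩ : Set.Ioi (0 : ℝ))) :=
      measurableSet_Iio
    have : ∀ r : Set.Ioi (0 : ℝ), F (z, r) =
        k z * (Set.Iio (⟨(c z)⁻¹, inv_pos.2 hz⟩ : Set.Ioi (0 : ℝ))).indicator 1 r := by
      intro r
      simp only [F, S, Set.indicator, Set.mem_ofPred_eq, Set.mem_Iio, ← Subtype.coe_lt_coe]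
      have hiff : (r : ℝ) * c z < 1 ↔ (r : ℝ) < (c z)⁻¹ := by
        rw [← one_div, lt_div_iff₀ hz]
      simp only [hiff]
      rfl
    simp only [this]
    rw [lintegral_const_mul _ (measurable_one.indicator hmS), lintegral_indicator_one hmS,
      Measure.volumeIoiPow_apply_Iio]

/-- The Lorentz boost on the light cone, projected to the space part. -/
noncomputable def auxG {E : Type*} [NormedAddCommGroup E] [InnerProductSpace ℝ E]
    (x y : E) : E := y + ((2 * ‖y‖ + 2 * ⟪x, y⟫) / (1 - ‖x‖ ^ 2)) • x

/-- The norm of `auxG x y`. -/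
noncomputable def auxC {E : Type*} [NormedAddCommGroup E] [InnerProductSpace ℝ E]
    (x y : E) : ℝ := (‖y‖ * (1 + ‖x‖ ^ 2) + 2 * ⟪x, y⟫) / (1 - ‖x‖ ^ 2)

section
variable {E : Type*} [NormedAddCommGroup E] [InnerProductSpace ℝ E]

lemma aux_pos {E : Type*} [NormedAddCommGroup E] {x : E} (hx : ‖x‖ < 1) : 0 < 1 - ‖x‖ ^ 2 := by
  nlinarith [norm_nonneg x]

lemma auxC_lower {x : E} (hx : ‖x‖ < 1) (y : E) :
    ‖y‖ * (1 - ‖x‖) ^ 2 / (1 - ‖x‖ ^ 2) ≤ auxC x y := by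
  unfold auxC
  have := aux_pos hx
  have h := neg_le_of_abs_le (abs_real_inner_le_norm x y)
  gcongr
  nlinarith

lemma auxC_nonneg {x : E} (hx : ‖x‖ < 1) (y : E) : 0 ≤ auxC x y := by
  have := aux_pos hx
  exact le_trans (by positivity) (auxC_lower hx y)

lemma auxC_pos {x : E} (hx : ‖x‖ < 1) (y : E) (hy : y ≠ 0) : 0 < auxC x y := by
  have := aux_pos hx
  have h2 : 0 < 1 - ‖x‖ := by linarith
  have h3 : 0 < ‖y‖ := norm_pos_iff.2 hy
  exact lt_of_lt_of_le (by positivity) (auxC_lower hx y)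

lemma auxG_norm {x : E} (hx : ‖x‖ < 1) (y : E) : ‖auxG x y‖ = auxC x y := by
  have h0 := aux_pos hx
  rw [← sq_eq_sq₀ (norm_nonneg _) (auxC_nonneg hx y)]
  unfold auxG auxC
  rw [norm_add_sq_real, inner_smul_right, norm_smul, mul_pow, Real.norm_eq_abs, sq_abs,
    real_inner_comm]
  field_simp
  ring

lemma auxG_inv {x : E} (hx : ‖x‖ < 1) (y : E) : auxG (-x) (auxG x y) = y := by
  have h0 := aux_pos hx
  rw [auxG.eq_1 (-x), auxG_norm hx]
  simp only [auxG, auxC, norm_neg, smul_neg, ← sub_eq_add_neg, inner_neg_left, inner_add_right,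
    inner_smul_right, real_inner_self_eq_norm_sq]
  rw [add_sub_assoc, ← sub_smul]
  convert add_zero y
  convert zero_smul ℝ x
  field_simp
  ring

lemma auxC_smul (x : E) {r : ℝ} (hr : 0 ≤ r) (y : E) : auxC x (r • y) = r * auxC x y := by
  simp only [auxC, norm_smul, inner_smul_right, Real.norm_eq_abs, abs_of_nonneg hr]
  ring

lemma auxG_smul (x : E) {r : ℝ} (hr : 0 ≤ r) (y : E) : auxG x (r • y) = r • auxG x y := by
  simp only [auxG, norm_smul, inner_smul_right, Real.norm_eq_abs, abs_of_nonneg hr, smul_add,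
    smul_smul]
  congr 2
  ring

lemma aux_norm_add {x z : E} (hz : ‖z‖ = 1) :
    ‖z + x‖ ^ 2 = 1 + ‖x‖ ^ 2 + 2 * ⟪x, z⟫ := by
  rw [norm_add_sq_real, hz, real_inner_comm]; ring

lemma auxC_sphere {x : E} {z : E} (hz : ‖z‖ = 1) :
    (auxC x z)⁻¹ = (1 - ‖x‖ ^ 2) / ‖z + x‖ ^ 2 := by
  rw [aux_norm_add hz, auxC, hz, inv_div]
  ring_nf

lemma aux_Mob_sphere {x : E} (hx : ‖x‖ < 1) {z : E} (hz : ‖z‖ = 1) :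
    Mob x z = (auxC x z)⁻¹ • auxG x z := by
  have h0 := aux_pos hx
  rw [auxC_sphere hz, aux_norm_add hz, Mob, auxG, hz]
  simp only [smul_add, smul_smul]
  congr 2 <;> field_simp
  ring

lemma aux_den_pos {x : E} (hx : ‖x‖ < 1) {z : E} (hz : ‖z‖ = 1) :
    0 < 1 + ‖x‖ ^ 2 + 2 * ⟪x, z⟫ := by
  have h := auxC_pos hx z (by rintro rfl; simp at hz)
  rw [auxC, hz, one_mul] at h
  exact (div_pos_iff_of_pos_right (aux_pos hx)).1 h

lemma aux_Mob_normalize {x : E} (hx : ‖x‖ < 1) {y : E} (hy : y ≠ 0) :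
    Mob x (‖y‖⁻¹ • y) = ‖auxG x y‖⁻¹ • auxG x y := by
  have h3 : 0 < ‖y‖ := norm_pos_iff.2 hy
  rw [aux_Mob_sphere hx (by simp [norm_smul, h3.ne']), auxC_smul x (by positivity),
    auxG_smul x (by positivity), auxG_norm hx, smul_smul]
  congr 1
  field_simp

/-- derivative of `auxG` -/
lemma auxG_deriv (x : E) {y : E} (hy : y ≠ 0) :
    HasFDerivAt (auxG x) (ContinuousLinearMap.id ℝ E +
      ((1 - ‖x‖ ^ 2)⁻¹ • ((2 * ‖y‖⁻¹) • innerSL ℝ y + (2 : ℝ) • innerSL ℝ x)).smulRight x) y := by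
  have hn : HasFDerivAt (fun y : E => ‖y‖) (‖y‖⁻¹ • innerSL ℝ y) y := by
    have h := ((hasStrictFDerivAt_norm_sq y).hasFDerivAt).sqrt (by simpa using hy)
    simp only [Real.sqrt_sq (norm_nonneg _)] at h
    convert! h using 1
    ext v
    simp
    ring
  have hi : HasFDerivAt (fun y : E => ⟪x, y⟫) (innerSL ℝ x) y := (innerSL ℝ x).hasFDerivAt
  have h := (hasFDerivAt_id y).add
    ((((hn.const_mul 2).add (hi.const_mul 2)).mul_const ((1 - ‖x‖ ^ 2)⁻¹)).smul_const x)
  convert! h using 1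
  ext v
  simp [smul_smul]

lemma auxG_det [FiniteDimensional ℝ E] {x : E} (hx : ‖x‖ < 1) {y : E} (hy : y ≠ 0) :
    (ContinuousLinearMap.id ℝ E +
      ((1 - ‖x‖ ^ 2)⁻¹ • ((2 * ‖y‖⁻¹) • innerSL ℝ y + (2 : ℝ) • innerSL ℝ x)).smulRight x).det
      = auxC x (‖y‖⁻¹ • y) := by
  have h0 := aux_pos hx
  have h3 : 0 < ‖y‖ := norm_pos_iff.2 hy
  have := LinearMap.transvection.det
    ((1 - ‖x‖ ^ 2)⁻¹ • ((2 * ‖y‖⁻¹) • innerSL ℝ y + (2 : ℝ) • innerSL ℝ x) : E →L[ℝ] ℝ).toLinearMap x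
  rw [auxC_smul x (by positivity)]
  refine Eq.trans ?_ (this.trans ?_)
  · rfl
  · simp [auxC, real_inner_comm]
    field_simp
    ring

lemma auxC_continuous (x : E) : Continuous (auxC x) := by
  unfold auxC; fun_prop

lemma auxG_image {x : E} (hx : ‖x‖ < 1) : auxG x '' {0}ᶜ = {0}ᶜ := by
  have h0 : ∀ x : E, auxG x 0 = 0 := by intro x; simp [auxG]
  ext y
  simp only [Set.mem_image, Set.mem_compl_iff, Set.mem_singleton_iff]
  constructor
  · rintro ⟨w, hw, rfl⟩ h
    apply hw
    rw [← auxG_inv hx w, h, h0]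
  · intro hy
    have h := auxG_inv (x := -x) (by simpa using hx) y
    rw [neg_neg] at h
    refine ⟨auxG (-x) y, fun h' => hy ?_, h⟩
    rw [← h, h', h0]

end

lemma aux_main {E : Type*} [NormedAddCommGroup E] [InnerProductSpace ℝ E]
    [FiniteDimensional ℝ E] [MeasurableSpace E] [BorelSpace E] (n : ℕ)
    (hdim : Module.finrank ℝ E = n + 1) {x : E} (hx : ‖x‖ < 1) (g : E → ENNReal)
    (hg : Measurable g) (hM : Measurable (Mob x)) :
    ∫⁻ z : sphere (0 : E) 1, g (Mob x z) * ENNReal.ofReal (((1 - ‖x‖ ^ 2) / ‖z.1 + x‖ ^ 2) ^ n)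
        ∂(volume : Measure E).toSphere
    = ∫⁻ z : sphere (0 : E) 1, g z ∂(volume : Measure E).toSphere := by
  have : Nontrivial E := Module.nontrivial_of_finrank_pos (R := ℝ) (by omega)
  have hCm := (auxC_continuous x).measurable
  have h1 := aux_polar n hdim g hg (fun _ => 1) measurable_const (fun _ _ => one_pos)
  have h2 := aux_polar n hdim (fun z => ENNReal.ofReal (auxC x z) * g (Mob x z))
    ((ENNReal.measurable_ofReal.comp hCm).mul (hg.comp hM)) (auxC x) hCm
    (fun z hz => auxC_pos hx z (by rintro rfl; simp at hz))
  have h3 := lintegral_image_eq_lintegral_abs_det_fderiv_mul (volume : Measure E)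
    (measurableSet_singleton (0 : E)).compl
    (fun y hy => (auxG_deriv x hy).hasFDerivWithinAt)
    ((Function.LeftInverse.injective (auxG_inv hx)).injOn)
    (fun y => g (‖y‖⁻¹ • y) * (Set.indicator {y : E | ‖y‖ * 1 < 1} 1 y))
  rw [auxG_image hx, restrict_compl_singleton] at h3
  rw [h3] at h1
  have h4 : ∫⁻ y in ({0}ᶜ : Set E), ENNReal.ofReal |(ContinuousLinearMap.id ℝ E +
      ((1 - ‖x‖ ^ 2)⁻¹ • ((2 * ‖y‖⁻¹) • innerSL ℝ y + (2 : ℝ) • innerSL ℝ x)).smulRight x).det|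
      * (g (‖auxG x y‖⁻¹ • auxG x y) * (Set.indicator {y : E | ‖y‖ * 1 < 1} 1 (auxG x y)))
      = ∫⁻ y in ({0}ᶜ : Set E), (ENNReal.ofReal (auxC x (‖y‖⁻¹ • y)) * g (Mob x (‖y‖⁻¹ • y))) *
        (Set.indicator {y : E | ‖y‖ * auxC x (‖y‖⁻¹ • y) < 1} 1 y) := by
    apply setLIntegral_congr_fun (measurableSet_singleton (0 : E)).compl
    intro y hy
    have hy' : y ≠ 0 := hy
    have h3 : 0 < ‖y‖ := norm_pos_iff.2 hy'
    simp only
    rw [auxG_det hx hy', abs_of_nonneg (auxC_nonneg hx _), aux_Mob_normalize hx hy', mul_assoc]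
    congr 2
    simp only [Set.indicator, Set.mem_ofPred_eq]
    have hiff : ‖auxG x y‖ * 1 < 1 ↔ ‖y‖ * auxC x (‖y‖⁻¹ • y) < 1 := by
      rw [auxG_norm hx, auxC_smul x (by positivity), mul_one, mul_inv_cancel_left₀ h3.ne']
    simp only [hiff]
    rfl
  rw [restrict_compl_singleton, h2] at h4
  rw [h4] at h1
  have hn : (0 : ℝ) < n + 1 := by positivity
  have key : ∀ a b : ENNReal, a * ENNReal.ofReal (1 / (n + 1)) = b * ENNReal.ofReal (1 / (n + 1)) →
      a = b := by
    intro a b hab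
    refine (ENNReal.mul_left_inj ?_ ENNReal.ofReal_ne_top).1 hab
    rw [← pos_iff_ne_zero, ENNReal.ofReal_pos]
    positivity
  apply key
  rw [← lintegral_mul_const', ← lintegral_mul_const']
  rotate_left
  · exact ENNReal.ofReal_ne_top
  · exact ENNReal.ofReal_ne_top
  refine Eq.trans ?_ (h1.trans ?_)
  · apply lintegral_congr
    intro z
    have hz : ‖z.1‖ = 1 := by simpa using z.2
    have hc := auxC_pos hx z.1 (by intro h; simp [h] at hz)
    rw [← auxC_sphere hz, mul_comm (ENNReal.ofReal (auxC x z)), mul_assoc, mul_assoc,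
      ← ENNReal.ofReal_mul (by positivity), ← ENNReal.ofReal_mul (by positivity)]
    congr 2
    rw [pow_succ]
    field_simp
  · apply lintegral_congr
    intro z
    simp

lemma aux_rot {E : Type*} [NormedAddCommGroup E] [InnerProductSpace ℝ E]
    [FiniteDimensional ℝ E] [MeasurableSpace E] [BorelSpace E] (n : ℕ)
    (hdim : Module.finrank ℝ E = n + 1) (g : E → ENNReal)
    (hg : Measurable g) (R : E ≃ₗᵢ[ℝ] E) :
    ∫⁻ z : sphere (0 : E) 1, g (R z) ∂(volume : Measure E).toSphere
    = ∫⁻ z : sphere (0 : E) 1, g z ∂(volume : Measure E).toSphere := by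
  have hR : Measurable R := R.continuous.measurable
  have h1 := aux_polar n hdim g hg (fun _ => 1) measurable_const (fun _ _ => one_pos)
  have h2 := aux_polar n hdim (fun z => g (R z)) (hg.comp hR) (fun _ => 1) measurable_const
    (fun _ _ => one_pos)
  have h3 := (R.measurePreserving).lintegral_comp_emb R.toHomeomorph.measurableEmbedding
    (fun y => g (‖y‖⁻¹ • y) * (Set.indicator {y : E | ‖y‖ * 1 < 1} 1 y))
  have h4 : ∫⁻ y, g (R (‖y‖⁻¹ • y)) * (Set.indicator {y : E | ‖y‖ * 1 < 1} 1 y)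
      = ∫⁻ y, g (‖R y‖⁻¹ • R y) * (Set.indicator {y : E | ‖y‖ * 1 < 1} 1 (R y)) := by
    apply lintegral_congr
    intro y
    simp [Set.indicator]
  rw [h4, h3, h1] at h2
  rw [lintegral_mul_const' _ _ ENNReal.ofReal_ne_top,
    lintegral_mul_const' _ _ ENNReal.ofReal_ne_top] at h2
  refine ((ENNReal.mul_left_inj ?_ ENNReal.ofReal_ne_top).1 h2).symm
  rw [← pos_iff_ne_zero, ENNReal.ofReal_pos]
  positivity

/-- `M_x` extends continuously to the unit sphere `S^n ⊆ ℝ^{n+1}`,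
maps it to itself, and its Jacobian with respect to the normalized spherical
measure `μ` at `ζ ∈ S^n` equals `((1-‖x‖²)/‖ζ+x‖²)^n`, expressed via the change
of variables formula `∫ g(M_x ζ) · Jac M_x(ζ) dμ(ζ) = ∫ g dμ`. -/
theorem Mob_sphere_jacobian (n : ℕ)
    (E : Type*) [NormedAddCommGroup E] [InnerProductSpace ℝ E]
    [FiniteDimensional ℝ E] [MeasurableSpace E] [BorelSpace E]
    (hdim : Module.finrank ℝ E = n + 1)
    (μ : Measure E) [IsProbabilityMeasure μ]
    (hsupp : μ (Metric.sphere (0 : E) 1)ᶜ = 0)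
    (hinv : ∀ R : E ≃ₗᵢ[ℝ] E, Measure.map R μ = μ)
    (x : E) (hx : ‖x‖ < 1) :
    ContinuousOn (Mob x) (Metric.sphere (0 : E) 1) ∧
    Set.MapsTo (Mob x) (Metric.sphere (0 : E) 1) (Metric.sphere (0 : E) 1) ∧
    (∀ g : E → ℝ, Continuous g →
      ∫ ζ, g (Mob x ζ) * ((1 - ‖x‖ ^ 2) / ‖ζ + x‖ ^ 2) ^ n ∂μ = ∫ ζ, g ζ ∂μ) := by
  have : Nontrivial E := Module.nontrivial_of_finrank_pos (R := ℝ) (by omega)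
  have hsph : ∀ z ∈ Metric.sphere (0 : E) 1, ‖z‖ = 1 := fun z hz => by simpa using hz
  have hMm : Measurable (Mob x) := by
    unfold Mob
    have h1 : Measurable fun z : E => 1 + ‖x‖ ^ 2 * ‖z‖ ^ 2 + 2 * ⟪x, z⟫ :=
      Continuous.measurable (by fun_prop)
    have h2 : Measurable fun z : E => (1 - ‖x‖ ^ 2) • z + (1 + ‖z‖ ^ 2 + 2 * ⟪x, z⟫) • x :=
      Continuous.measurable (by fun_prop)
    exact h1.inv.smul h2
  refine ⟨?_, ?_, ?_⟩
  · unfold Mob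
    refine ContinuousOn.smul (ContinuousOn.inv₀ (by fun_prop) ?_) (by fun_prop)
    intro z hz
    rw [hsph z hz]
    simpa using (aux_den_pos hx (hsph z hz)).ne'
  · intro z hz
    have hc := auxC_pos hx z (by rintro rfl; simp at hz)
    rw [mem_sphere_zero_iff_norm, aux_Mob_sphere hx (hsph z hz), norm_smul, auxG_norm hx,
      Real.norm_eq_abs, abs_of_pos (inv_pos.2 hc), inv_mul_cancel₀ hc.ne']
  intro g hg
  set σ : Measure E := (volume : Measure E).toSphere.map Subtype.val with hσ
  have hσl : ∀ f : E → ENNReal, Measurable f →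
      ∫⁻ z, f z ∂σ = ∫⁻ z : sphere (0 : E) 1, f z ∂(volume : Measure E).toSphere :=
    fun f hf => lintegral_map hf measurable_subtype_coe
  have hσu : σ Set.univ = (volume : Measure E).toSphere Set.univ := by
    rw [hσ, Measure.map_apply measurable_subtype_coe MeasurableSet.univ, Set.preimage_univ]
  have hκ0 : σ Set.univ ≠ 0 := by
    rw [hσu, Ne, Measure.measure_univ_eq_zero]
    exact Measure.toSphere_ne_zero _
  have hκt : σ Set.univ ≠ ⊤ := by
    rw [hσu]; exact measure_ne_top _ _
  have hprob : IsProbabilityMeasure ((σ Set.univ)⁻¹ • σ) :=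
    ⟨by rw [Measure.smul_apply, smul_eq_mul, ENNReal.inv_mul_cancel hκ0 hκt]⟩
  have hμσ : μ = (σ Set.univ)⁻¹ • σ := by
    refine aux_unique μ _ hsupp ?_ hinv ?_
    · rw [Measure.smul_apply, hσ, Measure.map_apply measurable_subtype_coe
        isClosed_sphere.measurableSet.compl]
      have he : (Subtype.val ⁻¹' (Metric.sphere (0 : E) 1)ᶜ : Set (sphere (0 : E) 1)) = ∅ := by
        ext z
        simp
      rw [he, measure_empty, smul_zero]
    · intro R
      have hR : Measurable R := R.continuous.measurable
      rw [Measure.map_smul]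
      congr 1
      refine Measure.ext_of_lintegral _ fun f hf => ?_
      rw [lintegral_map hf hR, hσl _ hf, hσl (fun z => f (R z)) (hf.comp hR), aux_rot n hdim f hf R]
  set J : E → ℝ := fun z => ((1 - ‖x‖ ^ 2) / ‖z + x‖ ^ 2) ^ n with hJ
  have hJm : Measurable J := by
    have h1 : Measurable fun z : E => ‖z + x‖ ^ 2 := Continuous.measurable (by fun_prop)
    exact (measurable_const.div h1).pow_const n
  have hJ0 : ∀ z, 0 ≤ J z := fun z => by
    have := aux_pos hx
    simp only [hJ]
    positivity
  have hJe : Measurable fun z => ENNReal.ofReal (J z) := ENNReal.measurable_ofReal.comp hJm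
  have hmap : (μ.withDensity fun z => ENNReal.ofReal (J z)).map (Mob x) = μ := by
    refine Measure.ext_of_lintegral _ fun f hf => ?_
    rw [lintegral_map hf hMm, lintegral_withDensity_eq_lintegral_mul _ hJe (g := fun z => f (Mob x z)) (hf.comp hMm), hμσ,
      lintegral_smul_measure, lintegral_smul_measure, hσl _ hf, hσl ((fun z => ENNReal.ofReal (J z)) * fun z => f (Mob x z)) (hJe.mul (hf.comp hMm)),
      ← aux_main n hdim hx f hf hMm]
    congr 1
    apply lintegral_congr
    intro z
    rw [Pi.mul_apply, mul_comm]
  conv_rhs => rw [← hmap]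
  rw [integral_map hMm.aemeasurable hg.aestronglyMeasurable,
    integral_withDensity_eq_integral_toReal_smul hJe
      (Filter.Eventually.of_forall fun _ => ENNReal.ofReal_lt_top)]
  congr 1
  ext z
  rw [ENNReal.toReal_ofReal (hJ0 z), smul_eq_mul, mul_comm]
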